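/- Let k : ℕ → ℕ satisfy k(x) ≥ 2 for all x and k(x)/log log x → 0 as x → ∞. Then Σ_{p ≤ x, p prime} (#S_{p,k(x),x})² = o((#S_{k(x),x})²) as x → ∞; that is, the ratio Σ_{p ≤ x} (#S_{p,k(x),x})² / (#S_{k(x),x})² tends to 0. -/

import Mathlib

open Finset Filter

/-- `S_{k,x} = {n ≤ x : ω(n) = Ω(n) = k}`, squarefree `n ≤ x` with exactly `k` prime factors. -/
def Skx (k x : ℕ) : Finset ℕ :=
  (Finset.Icc 1 x).filter fun n => Squarefree n ∧ n.primeFactors.card = k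

/-- `S_{p,k,x} = {n ∈ S_{k,x} : P(n) = p}`. -/
def Spkx (p k x : ℕ) : Finset ℕ :=
  (Skx k x).filter fun n => n.primeFactors.sup id = p

theorem mem_Skx {k x n : ℕ} :
    n ∈ Skx k x ↔ (1 ≤ n ∧ n ≤ x) ∧ Squarefree n ∧ n.primeFactors.card = k := by
  simp [Skx]

theorem dvd_of_mem_Spkx {p k x n : ℕ} (hp : p.Prime) (hn : n ∈ Spkx p k x) : p ∣ n := by
  have h := (mem_filter.1 hn).2
  have hne : n.primeFactors.Nonempty := by
    rw [nonempty_iff_ne_empty]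
    intro h0
    rw [h0, sup_empty] at h
    exact hp.ne_zero h.symm
  obtain ⟨q, hq, hqs⟩ := exists_mem_eq_sup _ hne id
  have : p = q := h ▸ hqs
  exact this ▸ Nat.dvd_of_mem_primeFactors hq

theorem card_primesLE_two_pow (n : ℕ) : n ≤ (Nat.primesLE (2 ^ n)).card := by
  induction n with
  | zero => simp
  | succ n ih =>
    obtain ⟨q, hq, hlt, hle⟩ := Nat.exists_prime_lt_and_le_two_mul (2 ^ n) (by positivity)
    have hsub : insert q (Nat.primesLE (2 ^ n)) ⊆ Nat.primesLE (2 ^ (n + 1)) := by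
      intro r hr
      rw [pow_succ']
      rcases mem_insert.1 hr with rfl | hr
      · exact Nat.mem_primesLE.2 ⟨hle, hq⟩
      · have := Nat.mem_primesLE.1 hr
        exact Nat.mem_primesLE.2 ⟨by omega, this.2⟩
    have hnot : q ∉ Nat.primesLE (2 ^ n) := fun h => by
      have := (Nat.mem_primesLE.1 h).1
      omega
    have := card_le_card hsub
    rw [card_insert_of_notMem hnot] at this
    omega

theorem pow_le_choose_mul (k M : ℕ) (hM : 1 ≤ M) : M ^ k ≤ (k * M).choose k := by
  induction k with
  | zero => simp
  | succ k ih =>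
    obtain ⟨m, rfl⟩ : ∃ m, M = m + 1 := ⟨M - 1, by omega⟩
    have h := Nat.add_one_mul_choose_eq (k * (m + 1) + m) k
    have h1 : k * (m + 1) + m + 1 = (k + 1) * (m + 1) := by ring
    rw [h1] at h
    have h2 : (m + 1) * (k * (m + 1) + m).choose k = ((k + 1) * (m + 1)).choose (k + 1) := by
      apply Nat.eq_of_mul_eq_mul_right (Nat.add_one_pos k)
      rw [← h]
      ring
    rw [← h2, pow_succ']
    exact Nat.mul_le_mul_left _ (ih.trans (Nat.choose_le_choose _ (by omega)))

theorem choose_le_card_Skx {k x N : ℕ} (hx : 2 ^ (N * k) ≤ x) :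
    N.choose k ≤ (Skx k x).card := by
  refine (Nat.choose_le_choose k (card_primesLE_two_pow N)).trans ?_
  rw [← card_powersetCard]
  refine card_le_card_of_injOn (fun s => ∏ p ∈ s, p) ?_ ?_
  · intro s hs
    obtain ⟨hsub, hcard⟩ := mem_powersetCard.1 hs
    have hprime : ∀ p ∈ s, p.Prime := fun p hp => (Nat.mem_primesLE.1 (hsub hp)).2
    refine mem_Skx.2 ⟨⟨prod_pos fun p hp => (hprime p hp).pos, ?_⟩, ?_, ?_⟩
    · refine le_trans ?_ hx
      rw [pow_mul, ← hcard]
      exact prod_le_pow_card _ _ _ fun p hp => (Nat.mem_primesLE.1 (hsub hp)).1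
    · refine squarefree_prod_of_pairwise_isCoprime (fun p hp q hq hpq => ?_)
        fun p hp => (hprime p hp).squarefree
      exact Nat.coprime_iff_isRelPrime.1
        ((Nat.coprime_primes (hprime p hp) (hprime q hq)).2 hpq)
    · rw [Nat.primeFactors_prod hprime, hcard]
  · intro s hs t ht hst
    have hprime : ∀ u ∈ powersetCard k (Nat.primesLE (2 ^ N)), ∀ p ∈ u, p.Prime :=
      fun u hu p hp => (Nat.mem_primesLE.1 ((mem_powersetCard.1 hu).1 hp)).2
    rw [← Nat.primeFactors_prod (hprime s hs), ← Nat.primeFactors_prod (hprime t ht)]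
    exact congrArg Nat.primeFactors hst

theorem card_Spkx_le_two_pow (p k x : ℕ) :
    (Spkx p k x).card ≤ 2 ^ (Nat.primesLE p).card := by
  rw [← card_powerset]
  refine card_le_card_of_injOn Nat.primeFactors ?_ ?_
  · intro n hn
    refine mem_powerset.2 fun q hq => Nat.mem_primesLE.2 ⟨?_, Nat.prime_of_mem_primeFactors hq⟩
    rw [← (mem_filter.1 hn).2]
    exact le_sup (f := id) hq
  · intro m hm n hn hmn
    have hsq : ∀ n ∈ Spkx p k x, Squarefree n :=
      fun n hn => (mem_Skx.1 (mem_filter.1 hn).1).2.1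
    rw [← Nat.prod_primeFactors_of_squarefree (hsq m hm),
      ← Nat.prod_primeFactors_of_squarefree (hsq n hn), hmn]

theorem mul_mem_Skx {p q m k x : ℕ} (hp : p.Prime) (hq : q.Prime) (hqp : q ≤ p)
    (hqm : ¬ q ∣ m) (h : p * m ∈ Skx k x) : q * m ∈ Skx k x := by
  obtain ⟨⟨h1, hx⟩, hsq, hcard⟩ := mem_Skx.1 h
  have hpm : p.Coprime m := Nat.coprime_of_squarefree_mul hsq
  have hqm' : q.Coprime m := (Nat.Prime.coprime_iff_not_dvd hq).2 hqm
  have hm : 0 < m := Nat.pos_of_mul_pos_left h1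
  refine mem_Skx.2 ⟨⟨Nat.mul_pos hq.pos hm, (Nat.mul_le_mul_right m hqp).trans hx⟩, ?_, ?_⟩
  · exact (Nat.squarefree_mul hqm').2 ⟨hq.squarefree, ((Nat.squarefree_mul hpm).1 hsq).2⟩
  · rw [hpm.primeFactors_mul, card_union_of_disjoint hpm.disjoint_primeFactors,
      hp.primeFactors, card_singleton] at hcard
    rw [hqm'.primeFactors_mul, card_union_of_disjoint hqm'.disjoint_primeFactors,
      hq.primeFactors, card_singleton, hcard]

/-- Replacing the largest prime factor `p` by the other primes up to `p` produces each element of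
`S_{k,x}` at most `k` times. -/
theorem card_Spkx_mul_le {p : ℕ} (k x : ℕ) (hp : p.Prime) :
    (Spkx p k x).card * ((Nat.primesLE p).card - k) ≤ (Skx k x).card * k := by
  have hleft : (Spkx p k x).card * ((Nat.primesLE p).card - k) ≤
      ((Spkx p k x).sigma fun n => Nat.primesLE p \ n.primeFactors).card := by
    rw [card_sigma, ← smul_eq_mul]
    refine card_nsmul_le_sum _ _ _ fun n hn => ?_
    rw [← (mem_Skx.1 (mem_filter.1 hn).1).2.2]
    exact le_card_sdiff _ _
  have hright : ((Skx k x).sigma fun n => n.primeFactors).card = (Skx k x).card * k := by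
    rw [card_sigma, sum_congr rfl fun n hn => (mem_Skx.1 hn).2.2, sum_const, smul_eq_mul]
  rw [← hright]
  refine hleft.trans (card_le_card_of_injOn (fun a => ⟨a.2 * (a.1 / p), a.2⟩) ?_ ?_)
  · rintro ⟨n, q⟩ h
    obtain ⟨hn, hq⟩ := mem_sigma.1 h
    obtain ⟨hqp, hqn⟩ := mem_sdiff.1 hq
    obtain ⟨hqp, hq⟩ := Nat.mem_primesLE.1 hqp
    obtain ⟨m, rfl⟩ := dvd_of_mem_Spkx hp hn
    have hS := (mem_filter.1 hn).1
    have hn0 : p * m ≠ 0 := Nat.ne_of_gt (mem_Skx.1 hS).1.1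
    have hqm : ¬ q ∣ m := fun hd =>
      hqn (Nat.mem_primeFactors.2 ⟨hq, hd.mul_left p, hn0⟩)
    have hmem := mul_mem_Skx hp hq hqp hqm hS
    simp only [Nat.mul_div_cancel_left m hp.pos]
    refine mem_sigma.2 ⟨hmem, Nat.mem_primeFactors.2 ⟨hq, dvd_mul_right q m,
      Nat.ne_of_gt (mem_Skx.1 hmem).1.1⟩⟩
  · rintro ⟨n, q⟩ h ⟨n', q'⟩ h' heq
    obtain ⟨hn, hq⟩ := mem_sigma.1 h
    obtain ⟨hn', hq'⟩ := mem_sigma.1 h'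
    have hqpos := (Nat.mem_primesLE.1 (mem_sdiff.1 hq).1).2.pos
    obtain ⟨m, rfl⟩ := dvd_of_mem_Spkx hp hn
    obtain ⟨m', rfl⟩ := dvd_of_mem_Spkx hp hn'
    simp only [Nat.mul_div_cancel_left _ hp.pos, Sigma.mk.injEq, heq_eq_eq] at heq
    obtain ⟨h1, rfl⟩ := heq
    rw [Nat.eq_of_mul_eq_mul_left hqpos h1]

theorem mul_card_Spkx_le {p k x T : ℕ} (hp : p.Prime) (hk : 1 ≤ k) (hT : 1 ≤ T)
    (hx : 2 ^ (k * (2 ^ (T + 1) * T) * k) ≤ x) :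
    T * (Spkx p k x).card ≤ (Skx k x).card := by
  by_cases h : (T + 1) * k ≤ (Nat.primesLE p).card
  · have h1 := card_Spkx_mul_le k x hp
    have h2 : T * k ≤ (Nat.primesLE p).card - k := by
      rw [add_mul, one_mul] at h
      omega
    have h3 := (Nat.mul_le_mul_left (Spkx p k x).card h2).trans h1
    refine Nat.le_of_mul_le_mul_right ?_ hk
    calc _ = (Spkx p k x).card * (T * k) := by ring
      _ ≤ _ := h3
  · calc T * (Spkx p k x).card
        ≤ T ^ k * 2 ^ ((T + 1) * k) := by
          refine Nat.mul_le_mul (Nat.le_self_pow (by omega) T)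
            ((card_Spkx_le_two_pow p k x).trans ?_)
          exact Nat.pow_le_pow_right (by norm_num) (by omega)
      _ = (2 ^ (T + 1) * T) ^ k := by rw [mul_pow, ← pow_mul, mul_comm]
      _ ≤ _ := pow_le_choose_mul k _ (Nat.mul_pos (by positivity) hT)
      _ ≤ _ := choose_le_card_Skx hx

theorem sum_card_Spkx_le (k x : ℕ) (s : Finset ℕ) :
    ∑ p ∈ s, (Spkx p k x).card ≤ (Skx k x).card := by
  simp only [Spkx]
  rw [sum_card_fiberwise_eq_card_filter]
  exact card_filter_le _ _

theorem sum_sq_card_Spkx_le {k x T : ℕ} (hk : 1 ≤ k) (hT : 1 ≤ T)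
    (hx : 2 ^ (k * (2 ^ (T + 1) * T) * k) ≤ x) :
    T * ∑ p ∈ (Icc 1 x).filter Nat.Prime, (Spkx p k x).card ^ 2 ≤ (Skx k x).card ^ 2 := by
  calc _ = ∑ p ∈ (Icc 1 x).filter Nat.Prime,
        (T * (Spkx p k x).card) * (Spkx p k x).card := by
        rw [mul_sum]
        exact sum_congr rfl fun p _ => by ring
    _ ≤ ∑ p ∈ (Icc 1 x).filter Nat.Prime, (Skx k x).card * (Spkx p k x).card :=
        sum_le_sum fun p hp =>
          Nat.mul_le_mul_right _ (mul_card_Spkx_le (mem_filter.1 hp).2 hk hT hx)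
    _ ≤ (Skx k x).card ^ 2 := by
        rw [← mul_sum, sq]
        exact Nat.mul_le_mul_left _ (sum_card_Spkx_le _ _ _)

theorem eventually_two_pow_le {k : ℕ → ℕ}
    (hko : Tendsto (fun x : ℕ => (k x : ℝ) / Real.log (Real.log x)) atTop (nhds 0)) (M : ℕ) :
    ∀ᶠ x in atTop, 2 ^ (k x * M * k x) ≤ x := by
  have hcast : Tendsto (fun x : ℕ => (x : ℝ)) atTop atTop := tendsto_natCast_atTop_atTop
  have hlog := Real.tendsto_log_atTop.comp hcast
  have hloglog := Real.tendsto_log_atTop.comp hlog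
  have ho := hlog.eventually ((Real.isLittleO_pow_log_id_atTop (n := 2)).bound
    (show (0 : ℝ) < 1 / (M + 1) by positivity))
  filter_upwards [hko.eventually (gt_mem_nhds one_pos), hloglog.eventually_gt_atTop 0,
    hlog.eventually_gt_atTop 0, hcast.eventually_gt_atTop 0, ho] with x h1 h2 h3 h4 h5
  simp only [Function.comp_apply] at h2 h3 h5
  rw [div_lt_one h2] at h1
  rw [Real.norm_of_nonneg (by positivity), id, Real.norm_of_nonneg h3.le, one_div,
    inv_mul_eq_div, le_div_iff₀ (by positivity)] at h5
  have hsq : (k x : ℝ) ^ 2 ≤ Real.log (Real.log x) ^ 2 := by gcongr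
  have hlog2 : Real.log 2 ≤ 1 := Real.log_two_lt_d9.le.trans (by norm_num)
  have key : ((k x * M * k x : ℕ) : ℝ) * Real.log 2 ≤ Real.log x := by
    calc ((k x * M * k x : ℕ) : ℝ) * Real.log 2
        ≤ ((k x * M * k x : ℕ) : ℝ) * 1 := by gcongr
      _ = (k x : ℝ) ^ 2 * M := by push_cast; ring
      _ ≤ Real.log (Real.log x) ^ 2 * (M + 1) := by gcongr; linarith
      _ ≤ _ := h5
  rw [← Real.log_pow] at key
  have := (Real.log_le_log_iff (by positivity) h4).1 key
  exact_mod_cast this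

theorem stmt_14 (k : ℕ → ℕ) (hk : ∀ x, 2 ≤ k x)
    (hko : Tendsto (fun x : ℕ => (k x : ℝ) / Real.log (Real.log x)) atTop (nhds 0)) :
    Tendsto (fun x : ℕ =>
        (∑ p ∈ (Finset.Icc 1 x).filter Nat.Prime, ((Spkx p (k x) x).card : ℝ) ^ 2) /
          ((Skx (k x) x).card : ℝ) ^ 2)
      atTop (nhds 0) := by
  rw [Metric.tendsto_nhds]
  intro ε hε
  obtain ⟨t, ht⟩ := exists_nat_one_div_lt hε
  filter_upwards [eventually_two_pow_le hko (2 ^ (t + 1 + 1) * (t + 1))] with x hx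
  have h := sum_sq_card_Spkx_le (one_le_two.trans (hk x)) (Nat.le_add_left 1 t) hx
  have h' : ((t : ℝ) + 1) * ∑ p ∈ (Finset.Icc 1 x).filter Nat.Prime,
      ((Spkx p (k x) x).card : ℝ) ^ 2 ≤ ((Skx (k x) x).card : ℝ) ^ 2 := by exact_mod_cast h
  have hsum := sum_nonneg fun p (_ : p ∈ (Finset.Icc 1 x).filter Nat.Prime) =>
    sq_nonneg ((Spkx p (k x) x).card : ℝ)
  rw [dist_zero_right, Real.norm_of_nonneg (div_nonneg hsum (sq_nonneg _))]
  refine lt_of_le_of_lt (div_le_of_le_mul₀ (sq_nonneg _) (by positivity) ?_) ht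
  rw [one_div, inv_mul_eq_div, le_div_iff₀ (by positivity), mul_comm]
  exact h'
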